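/- Let m, n ∈ ℕ and s, r', r'' ∈ ℝ satisfy s ≤ r' + min{0, r''} and s ≤ r'' + min{0, r'}. Then for all measurable functions F : ℝ^m → ℂ and G : ℝ^n → ℂ one has (∫_{ℝ^m}∫_{ℝ^n} ⟨(ξ,η)⟩^{2s} |F(ξ)|² |G(η)|² dη dξ)^{1/2} ≤ ‖⟨·⟩^{r'} F‖_{L²(ℝ^m)} · ‖⟨·⟩^{r''} G‖_{L²(ℝ^n)}, where both sides are interpreted as values in [0,∞]. -/

import Mathlib

open scoped ENNReal
open MeasureTheory

/-- The Japanese bracket `⟨x⟩ = (1 + |x|²)^(1/2)`. -/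
noncomputable def jb {E : Type*} [NormedAddCommGroup E] (x : E) : ℝ :=
  Real.sqrt (1 + ‖x‖ ^ 2)

/-- Concatenation of `ξ ∈ ℝ^m` and `η ∈ ℝ^n` into `(ξ, η) ∈ ℝ^(m+n)`. -/
noncomputable def concatE {m n : ℕ} (ξ : EuclideanSpace ℝ (Fin m))
    (η : EuclideanSpace ℝ (Fin n)) : EuclideanSpace ℝ (Fin (m + n)) :=
  (EuclideanSpace.equiv (Fin (m + n)) ℝ).symm
    (Fin.append (fun i => ξ i) (fun j => η j))

theorem one_le_jb {E : Type*} [NormedAddCommGroup E] (x : E) : 1 ≤ jb x :=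
  Real.one_le_sqrt.2 (by nlinarith [sq_nonneg ‖x‖])

theorem measurable_jb {E : Type*} [NormedAddCommGroup E] [MeasurableSpace E]
    [OpensMeasurableSpace E] : Measurable (jb : E → ℝ) := by
  unfold jb
  fun_prop

theorem norm_sq_concatE {m n : ℕ} (ξ : EuclideanSpace ℝ (Fin m))
    (η : EuclideanSpace ℝ (Fin n)) : ‖concatE ξ η‖ ^ 2 = ‖ξ‖ ^ 2 + ‖η‖ ^ 2 := by
  simp [EuclideanSpace.norm_sq_eq, concatE, Fin.sum_univ_add]

theorem jb_left_le_jb_concatE {m n : ℕ} (ξ : EuclideanSpace ℝ (Fin m))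
    (η : EuclideanSpace ℝ (Fin n)) : jb ξ ≤ jb (concatE ξ η) := by
  apply Real.sqrt_le_sqrt
  nlinarith [norm_sq_concatE ξ η, sq_nonneg ‖η‖]

theorem jb_right_le_jb_concatE {m n : ℕ} (ξ : EuclideanSpace ℝ (Fin m))
    (η : EuclideanSpace ℝ (Fin n)) : jb η ≤ jb (concatE ξ η) := by
  apply Real.sqrt_le_sqrt
  nlinarith [norm_sq_concatE ξ η, sq_nonneg ‖ξ‖]

theorem jb_concatE_le_mul {m n : ℕ} (ξ : EuclideanSpace ℝ (Fin m))
    (η : EuclideanSpace ℝ (Fin n)) : jb (concatE ξ η) ≤ jb ξ * jb η := by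
  unfold jb
  rw [← Real.sqrt_mul (by positivity), norm_sq_concatE]
  apply Real.sqrt_le_sqrt
  nlinarith [mul_nonneg (sq_nonneg ‖ξ‖) (sq_nonneg ‖η‖)]

/-- If `max a b ≤ c ≤ a * b` with `a, b ≥ 1`, then `c ^ s ≤ a ^ p * b ^ q` for all exponents
with `s ≤ p + min 0 q` and `s ≤ q + min 0 p`. -/
theorem rpow_le_rpow_mul_rpow {a b c s p q : ℝ} (ha : 1 ≤ a) (hb : 1 ≤ b) (hac : a ≤ c)
    (hbc : b ≤ c) (hc : c ≤ a * b) (h1 : s ≤ p + min 0 q) (h2 : s ≤ q + min 0 p) :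
    c ^ s ≤ a ^ p * b ^ q := by
  have ha0 : 0 < a := by linarith
  have hb0 : 0 < b := by linarith
  have hc0 : 0 < c := by linarith
  have hc1 : 1 ≤ c := by linarith
  rcases le_total 0 p with hp | hp <;> rcases le_total 0 q with hq | hq
  · rw [min_eq_left hq] at h1
    rw [min_eq_left hp] at h2
    calc c ^ s ≤ c ^ min p q :=
          Real.rpow_le_rpow_of_exponent_le hc1 (le_min (by simpa using h1) (by simpa using h2))
      _ ≤ (a * b) ^ min p q := Real.rpow_le_rpow hc0.le hc (le_min hp hq)
      _ = a ^ min p q * b ^ min p q := Real.mul_rpow ha0.le hb0.le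
      _ ≤ a ^ p * b ^ q := by
        gcongr
        · exact min_le_left _ _
        · exact min_le_right _ _
  · rw [min_eq_left hp] at h2
    calc c ^ s ≤ c ^ q := Real.rpow_le_rpow_of_exponent_le hc1 (by simpa using h2)
      _ ≤ b ^ q := Real.rpow_le_rpow_of_nonpos hb0 hbc hq
      _ ≤ a ^ p * b ^ q :=
        le_mul_of_one_le_left (Real.rpow_nonneg hb0.le q) (Real.one_le_rpow ha hp)
  · rw [min_eq_left hq] at h1
    calc c ^ s ≤ c ^ p := Real.rpow_le_rpow_of_exponent_le hc1 (by simpa using h1)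
      _ ≤ a ^ p := Real.rpow_le_rpow_of_nonpos ha0 hac hp
      _ ≤ a ^ p * b ^ q :=
        le_mul_of_one_le_right (Real.rpow_nonneg ha0.le p) (Real.one_le_rpow hb hq)
  · rw [min_eq_right hq] at h1
    calc c ^ s ≤ c ^ (p + q) := Real.rpow_le_rpow_of_exponent_le hc1 h1
      _ = c ^ p * c ^ q := Real.rpow_add hc0 p q
      _ ≤ a ^ p * b ^ q :=
        mul_le_mul (Real.rpow_le_rpow_of_nonpos ha0 hac hp)
          (Real.rpow_le_rpow_of_nonpos hb0 hbc hq) (by positivity) (by positivity)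

theorem jb_concatE_rpow_le {m n : ℕ} {s p q : ℝ} (h1 : s ≤ p + min 0 q) (h2 : s ≤ q + min 0 p)
    (ξ : EuclideanSpace ℝ (Fin m)) (η : EuclideanSpace ℝ (Fin n)) :
    jb (concatE ξ η) ^ (2 * s) ≤ jb ξ ^ (2 * p) * jb η ^ (2 * q) := by
  have hmin (x : ℝ) : min 0 (2 * x) = 2 * min 0 x := by
    simpa using (mul_min_of_nonneg 0 x (zero_le_two (α := ℝ))).symm
  refine rpow_le_rpow_mul_rpow (one_le_jb ξ) (one_le_jb η) (jb_left_le_jb_concatE ξ η)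
    (jb_right_le_jb_concatE ξ η) (jb_concatE_le_mul ξ η) ?_ ?_ <;> rw [hmin] <;> linarith

theorem stmt_1 (m n : ℕ) (s r' r'' : ℝ)
    (h1 : s ≤ r' + min 0 r'') (h2 : s ≤ r'' + min 0 r')
    (F : EuclideanSpace ℝ (Fin m) → ℂ) (G : EuclideanSpace ℝ (Fin n) → ℂ)
    (hF : Measurable F) (hG : Measurable G) :
    (∫⁻ ξ, ∫⁻ η,
        ENNReal.ofReal (jb (concatE ξ η) ^ (2 * s)) * (‖F ξ‖₊ : ℝ≥0∞) ^ 2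
          * (‖G η‖₊ : ℝ≥0∞) ^ 2) ^ (1 / 2 : ℝ)
      ≤ (∫⁻ ξ, ENNReal.ofReal (jb ξ ^ (2 * r')) * (‖F ξ‖₊ : ℝ≥0∞) ^ 2) ^ (1 / 2 : ℝ)
        * (∫⁻ η, ENNReal.ofReal (jb η ^ (2 * r'')) * (‖G η‖₊ : ℝ≥0∞) ^ 2) ^ (1 / 2 : ℝ) := by
  rw [← ENNReal.mul_rpow_of_nonneg _ _ (by norm_num : (0 : ℝ) ≤ 1 / 2)]
  refine ENNReal.rpow_le_rpow ?_ (by norm_num)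
  have hmF : Measurable fun ξ => ENNReal.ofReal (jb ξ ^ (2 * r')) * (‖F ξ‖₊ : ℝ≥0∞) ^ 2 :=
    (measurable_jb.pow_const _).ennreal_ofReal.mul (hF.nnnorm.coe_nnreal_ennreal.pow_const 2)
  have hmG : Measurable fun η => ENNReal.ofReal (jb η ^ (2 * r'')) * (‖G η‖₊ : ℝ≥0∞) ^ 2 :=
    (measurable_jb.pow_const _).ennreal_ofReal.mul (hG.nnnorm.coe_nnreal_ennreal.pow_const 2)
  rw [← lintegral_mul_const _ hmF]
  refine lintegral_mono fun ξ => ?_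
  rw [← lintegral_const_mul _ hmG]
  refine lintegral_mono fun η => ?_
  have hle := ENNReal.ofReal_le_ofReal (jb_concatE_rpow_le h1 h2 ξ η)
  rw [ENNReal.ofReal_mul (Real.rpow_nonneg (zero_le_one.trans (one_le_jb ξ)) _)] at hle
  calc _ ≤ ENNReal.ofReal (jb ξ ^ (2 * r')) * ENNReal.ofReal (jb η ^ (2 * r''))
          * (‖F ξ‖₊ : ℝ≥0∞) ^ 2 * (‖G η‖₊ : ℝ≥0∞) ^ 2 := by gcongr
    _ = _ := by ring
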